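/- Let B ∈ End(ℂ^{2n}) and let 𝒫_t, 𝒫_0 be the model Gaussian kernels as above. Then ∫_{ℝ^{2n}} 𝒫_t(Z,W)⟨B(Z−W),(Z−W)⟩𝒫_0(W,Z') dW = (⟨B conj(Π_t^0)(Z−Z'), conj(Π_t^0)(Z−Z')⟩ + (1/2π)Tr[A_t^0 B]) · (𝒫_t𝒫_0)(Z,Z') for all Z,Z' ∈ ℝ^{2n}, where conj(Π_t^0) is the complex conjugate of Π_t^0 and (𝒫_t𝒫_0)(Z,Z') = det(A_t^0)^{1/2} exp(−π[⟨Π_0^t(Z−Z'),(Z−Z')⟩ + iΩ(Z,Z')]). -/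

import Mathlib

open Matrix MeasureTheory

noncomputable section

/-- Standard complex structure on ℝ^{2n}: J₀ e_{2k} = e_{2k+1}, J₀ e_{2k+1} = -e_{2k}. -/
def J0 (n : ℕ) : Matrix (Fin (2*n)) (Fin (2*n)) ℝ :=
  Matrix.of fun i j =>
    if (i : ℕ) = (j : ℕ) + 1 ∧ (j : ℕ) % 2 = 0 then 1
    else if (j : ℕ) = (i : ℕ) + 1 ∧ (i : ℕ) % 2 = 0 then -1 else 0

/-- Standard symplectic form Ω(u,v) = ⟨J₀ u, v⟩. -/
def Omega (n : ℕ) (u v : Fin (2*n) → ℝ) : ℝ := (J0 n *ᵥ u) ⬝ᵥ v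

/-- A complex structure J compatible with Ω: J² = -Id, Ω is J-invariant,
and ⟨·,·⟩_J := Ω(·, J·) is positive definite. -/
def Compatible (n : ℕ) (J : Matrix (Fin (2*n)) (Fin (2*n)) ℝ) : Prop :=
  J * J = -1 ∧ (∀ u v, Omega n (J *ᵥ u) (J *ᵥ v) = Omega n u v) ∧
    ∀ v : Fin (2*n) → ℝ, v ≠ 0 → 0 < Omega n v (J *ᵥ v)

/-- Complexification of a real matrix. -/
def mc {m : ℕ} (M : Matrix (Fin m) (Fin m) ℝ) : Matrix (Fin m) (Fin m) ℂ :=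
  M.map (fun x => (x : ℂ))

/-- Complexification of a real vector. -/
def vc {m : ℕ} (v : Fin m → ℝ) : Fin m → ℂ := fun i => (v i : ℂ)

/-- Projection P^{(1,0)} = ½(Id - iK) onto the +i eigenspace of K. -/
def P10 {n : ℕ} (K : Matrix (Fin (2*n)) (Fin (2*n)) ℝ) : Matrix (Fin (2*n)) (Fin (2*n)) ℂ :=
  (1/2 : ℂ) • (1 - Complex.I • mc K)

/-- Projection P^{(0,1)} = ½(Id + iK) onto the -i eigenspace of K. -/
def P01 {n : ℕ} (K : Matrix (Fin (2*n)) (Fin (2*n)) ℝ) : Matrix (Fin (2*n)) (Fin (2*n)) ℂ :=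
  (1/2 : ℂ) • (1 + Complex.I • mc K)

/-- `Amat n K J = (½(Id + (-K)·J))⁻¹`; so `Amat n (J0 n) J` is A_t^0 and
`Amat n J (J0 n)` is A_0^t. -/
def Amat (n : ℕ) (K J : Matrix (Fin (2*n)) (Fin (2*n)) ℝ) : Matrix (Fin (2*n)) (Fin (2*n)) ℝ :=
  ((1/2 : ℝ) • (1 + (-K) * J))⁻¹

/-- Π_t^0 = A_t^0 · P₀^{(1,0)}, the projection onto V_t^{(1,0)} with kernel V₀^{(0,1)}. -/
def PiT0 (n : ℕ) (J : Matrix (Fin (2*n)) (Fin (2*n)) ℝ) : Matrix (Fin (2*n)) (Fin (2*n)) ℂ :=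
  mc (Amat n (J0 n) J) * P10 (J0 n)

/-- Π_0^t = A_0^t · P_t^{(1,0)}, the projection onto V₀^{(1,0)} with kernel V_t^{(0,1)}. -/
def Pi0T (n : ℕ) (J : Matrix (Fin (2*n)) (Fin (2*n)) ℝ) : Matrix (Fin (2*n)) (Fin (2*n)) ℂ :=
  mc (Amat n J (J0 n)) * P10 J

/-- Model Bergman kernel 𝒫_J(Z,Z') = exp(-(π/2)⟨(-J₀J)(Z-Z'),Z-Z'⟩ - πiΩ(Z,Z')). -/
def Pker (n : ℕ) (J : Matrix (Fin (2*n)) (Fin (2*n)) ℝ) (Z Z' : Fin (2*n) → ℝ) : ℂ :=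
  Complex.exp (-(Real.pi : ℂ)/2 * Complex.ofReal ((((-(J0 n)) * J) *ᵥ (Z - Z')) ⬝ᵥ (Z - Z'))
    - (Real.pi : ℂ) * Complex.I * Complex.ofReal (Omega n Z Z'))

/-- Closed formula for the composed kernel (𝒫_t𝒫_0)(Z,Z'). -/
def PtP0form (n : ℕ) (J : Matrix (Fin (2*n)) (Fin (2*n)) ℝ) (Z Z' : Fin (2*n) → ℝ) : ℂ :=
  Complex.ofReal (Real.sqrt (Amat n (J0 n) J).det) *
    Complex.exp (-(Real.pi : ℂ) *
      ((Pi0T n J *ᵥ (vc Z - vc Z')) ⬝ᵥ (vc Z - vc Z')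
        + Complex.I * Complex.ofReal (Omega n Z Z')))

/-- The one-dimensional Gaussian `exp (-π x² + 2π m x)` with complex mean `m`. -/
def shiftedGaussian (m : ℂ) (x : ℝ) : ℂ :=
  Complex.exp (-(Real.pi : ℂ) * x ^ 2 + 2 * Real.pi * m * x)

lemma integrable_shiftedGaussian (m : ℂ) : Integrable (shiftedGaussian m) := by
  have h := integrable_cexp_quadratic (b := (Real.pi : ℂ)) (by simpa using Real.pi_pos)
    (2 * Real.pi * m) 0
  simpa [funext (shiftedGaussian.eq_1 m)] using h

lemma hasDerivAt_shiftedGaussian (m : ℂ) (x : ℝ) :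
    HasDerivAt (shiftedGaussian m)
      ((-2 * Real.pi * x + 2 * Real.pi * m) * shiftedGaussian m x) x := by
  have h : HasDerivAt (fun z : ℂ => Complex.exp (-(Real.pi : ℂ) * z ^ 2 + 2 * Real.pi * m * z))
      ((-2 * Real.pi * x + 2 * Real.pi * m) * shiftedGaussian m x) (x : ℂ) := by
    have h1 := (((hasDerivAt_id (x : ℂ)).pow 2).const_mul (-(Real.pi : ℂ))).add
      ((hasDerivAt_id (x : ℂ)).const_mul (2 * Real.pi * m))
    convert! h1.cexp using 1
    simp [shiftedGaussian]
    ring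
  exact h.comp_ofReal

lemma norm_pow_mul_shiftedGaussian_le (m : ℂ) (k : ℕ) (x : ℝ) :
    ‖(x : ℂ) ^ k * shiftedGaussian m x‖ ≤ (k.factorial : ℝ) *
      (‖shiftedGaussian (m + 1 / (2 * Real.pi)) x‖ +
        ‖shiftedGaussian (m - 1 / (2 * Real.pi)) x‖) := by
  have hpi : (Real.pi : ℂ) ≠ 0 := by exact_mod_cast Real.pi_ne_zero
  have e1 : shiftedGaussian (m + 1 / (2 * Real.pi)) x =
      Complex.exp x * shiftedGaussian m x := by
    rw [shiftedGaussian, shiftedGaussian, ← Complex.exp_add]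
    congr 1
    field_simp
    ring
  have e2 : shiftedGaussian (m - 1 / (2 * Real.pi)) x =
      Complex.exp (-x) * shiftedGaussian m x := by
    rw [shiftedGaussian, shiftedGaussian, ← Complex.exp_add]
    congr 1
    field_simp
    ring
  rw [e1, e2, norm_mul, norm_mul, norm_mul, ← add_mul, ← mul_assoc]
  gcongr
  rw [norm_pow, Complex.norm_real, Real.norm_eq_abs, Complex.norm_exp, Complex.norm_exp,
    Complex.neg_re, Complex.ofReal_re]
  have h1 := Real.pow_div_factorial_le_exp |x| (abs_nonneg x) k
  rw [div_le_iff₀' (by positivity)] at h1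
  refine h1.trans ?_
  gcongr
  exact Real.exp_abs_le x

lemma integrable_pow_mul_shiftedGaussian (m : ℂ) (k : ℕ) :
    Integrable fun x : ℝ => (x : ℂ) ^ k * shiftedGaussian m x := by
  refine Integrable.mono' (((integrable_shiftedGaussian (m + 1 / (2 * Real.pi))).norm.add
    (integrable_shiftedGaussian (m - 1 / (2 * Real.pi))).norm).const_mul (k.factorial : ℝ)) ?_
    (.of_forall fun x => norm_pow_mul_shiftedGaussian_le m k x)
  have : Continuous (shiftedGaussian m) := by unfold shiftedGaussian; fun_prop
  exact Continuous.aestronglyMeasurable (by fun_prop)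

lemma integral_shiftedGaussian (m : ℂ) :
    ∫ x, shiftedGaussian m x = Complex.exp (Real.pi * m ^ 2) := by
  have hpi : (Real.pi : ℂ) ≠ 0 := by exact_mod_cast Real.pi_ne_zero
  have h := integral_cexp_quadratic (b := -(Real.pi : ℂ)) (by simpa using Real.pi_pos)
    (2 * Real.pi * m) 0
  simp only [add_zero, neg_neg, div_self hpi, Complex.one_cpow, one_mul] at h
  simp only [shiftedGaussian, h]
  congr 1
  field_simp
  ring

lemma integral_mul_shiftedGaussian (m : ℂ) :
    ∫ x : ℝ, (x : ℂ) * shiftedGaussian m x = m * ∫ x, shiftedGaussian m x := by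
  have hpi : (Real.pi : ℂ) ≠ 0 := by exact_mod_cast Real.pi_ne_zero
  have i0 := integrable_shiftedGaussian m
  have i1 : Integrable fun x : ℝ => (x : ℂ) * shiftedGaussian m x := by
    simpa using integrable_pow_mul_shiftedGaussian m 1
  have e : ∀ x : ℝ, (-2 * Real.pi * x + 2 * Real.pi * m) * shiftedGaussian m x =
      (-2 * Real.pi) * (x * shiftedGaussian m x) + (2 * Real.pi * m) * shiftedGaussian m x :=
    fun x => by ring
  have hd := hasDerivAt_shiftedGaussian m
  simp only [e] at hd
  have h := integral_eq_zero_of_hasDerivAt_of_integrable hd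
    ((i1.const_mul _).add (i0.const_mul _)) i0
  rw [integral_add (i1.const_mul _) (i0.const_mul _), integral_const_mul, integral_const_mul] at h
  refine mul_left_cancel₀ (mul_ne_zero two_ne_zero hpi) ?_
  linear_combination -h

lemma integral_sq_mul_shiftedGaussian (m : ℂ) :
    ∫ x : ℝ, (x : ℂ) ^ 2 * shiftedGaussian m x =
      (m ^ 2 + 1 / (2 * Real.pi)) * ∫ x, shiftedGaussian m x := by
  have hpi : (Real.pi : ℂ) ≠ 0 := by exact_mod_cast Real.pi_ne_zero
  have i0 := integrable_shiftedGaussian m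
  have i1 : Integrable fun x : ℝ => (x : ℂ) * shiftedGaussian m x := by
    simpa using integrable_pow_mul_shiftedGaussian m 1
  have i2 := integrable_pow_mul_shiftedGaussian m 2
  have hd : ∀ x : ℝ, HasDerivAt (fun x : ℝ => (x : ℂ) * shiftedGaussian m x)
      (shiftedGaussian m x + ((-2 * Real.pi) * ((x : ℂ) ^ 2 * shiftedGaussian m x) +
        (2 * Real.pi * m) * (x * shiftedGaussian m x))) x := fun x => by
    have hx : HasDerivAt (fun x : ℝ => (x : ℂ)) 1 x := (hasDerivAt_id x).ofReal_comp
    convert! hx.mul (hasDerivAt_shiftedGaussian m x) using 1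
    ring
  have i12 : Integrable fun x : ℝ => (-2 * Real.pi) * ((x : ℂ) ^ 2 * shiftedGaussian m x) +
      (2 * Real.pi * m) * (x * shiftedGaussian m x) := (i2.const_mul _).add (i1.const_mul _)
  have h := integral_eq_zero_of_hasDerivAt_of_integrable hd (i0.add i12) i1
  rw [integral_add i0 i12, integral_add (i2.const_mul _) (i1.const_mul _), integral_const_mul,
    integral_const_mul, integral_mul_shiftedGaussian] at h
  refine mul_left_cancel₀ (mul_ne_zero two_ne_zero hpi) ?_
  have : 2 * (Real.pi : ℂ) * (1 / (2 * Real.pi)) = 1 := by field_simp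
  linear_combination -h - (∫ x, shiftedGaussian m x) * this

lemma integral_coord_mul_coord_mul_prod_shiftedGaussian {ι : Type*} [Fintype ι] [DecidableEq ι]
    (m : ι → ℂ) (i j : ι) :
    Integrable (fun v : ι → ℝ => (v i : ℂ) * v j * ∏ k, shiftedGaussian (m k) (v k)) ∧
    ∫ v : ι → ℝ, (v i : ℂ) * v j * ∏ k, shiftedGaussian (m k) (v k) =
      (m i * m j + if i = j then 1 / (2 * (Real.pi : ℂ)) else 0) *
        Complex.exp (Real.pi * ∑ k, m k ^ 2) := by
  set f : ι → ℝ → ℂ := fun k x =>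
    (x : ℂ) ^ ((if k = i then 1 else 0) + if k = j then 1 else 0) * shiftedGaussian (m k) x with hf
  have hprod (v : ι → ℝ) : (v i : ℂ) * v j * ∏ k, shiftedGaussian (m k) (v k) =
      ∏ k, f k (v k) := by
    simp only [hf, pow_add, Finset.prod_mul_distrib]
    simp [pow_ite]
  simp only [hprod]
  refine ⟨Integrable.fintype_prod fun k => integrable_pow_mul_shiftedGaussian _ _, ?_⟩
  rw [integral_fintype_prod_volume_eq_prod]
  have hk (k : ι) : ∫ x, f k x = ((if k = i then m k else 1) * (if k = j then m k else 1) +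
      if k = i ∧ k = j then 1 / (2 * (Real.pi : ℂ)) else 0) * Complex.exp (Real.pi * m k ^ 2) := by
    rw [← integral_shiftedGaussian]
    by_cases hi : k = i <;> by_cases hj : k = j
    · simpa [hf, ← hi, ← hj, sq] using integral_sq_mul_shiftedGaussian (m k)
    · simp [hf, ← hi, hj, integral_mul_shiftedGaussian]
    · simp [hf, ← hj, hi, integral_mul_shiftedGaussian]
    · simp [hf, hi, hj]
  simp only [hk]
  rw [Finset.prod_mul_distrib, ← Complex.exp_sum, ← Finset.mul_sum]
  congr 1
  by_cases hij : i = j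
  · subst hij
    rw [Finset.prod_eq_single i] <;> simp +contextual
  · have (k : ι) : ¬ (k = i ∧ k = j) := fun h => hij (h.1.symm.trans h.2)
    simp only [this, hij, if_false, add_zero, Finset.prod_mul_distrib]
    simp

lemma integral_quadratic_mul_gaussian {N : ℕ} (B : Matrix (Fin N) (Fin N) ℂ) (m : Fin N → ℂ) :
    ∫ v : Fin N → ℝ, ((B *ᵥ vc v) ⬝ᵥ vc v) *
        Complex.exp (-(Real.pi : ℂ) * ((v ⬝ᵥ v : ℝ) : ℂ) + 2 * Real.pi * (m ⬝ᵥ vc v)) =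
      ((B *ᵥ m) ⬝ᵥ m + 1 / (2 * (Real.pi : ℂ)) * B.trace) * Complex.exp (Real.pi * (m ⬝ᵥ m)) := by
  have h (v : Fin N → ℝ) : ((B *ᵥ vc v) ⬝ᵥ vc v) *
      Complex.exp (-(Real.pi : ℂ) * ((v ⬝ᵥ v : ℝ) : ℂ) + 2 * Real.pi * (m ⬝ᵥ vc v)) =
      ∑ i, ∑ j, B i j * ((v i : ℂ) * v j * ∏ k, shiftedGaussian (m k) (v k)) := by
    have e : Complex.exp (-(Real.pi : ℂ) * ((v ⬝ᵥ v : ℝ) : ℂ) + 2 * Real.pi * (m ⬝ᵥ vc v)) =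
        ∏ k, shiftedGaussian (m k) (v k) := by
      simp only [shiftedGaussian, ← Complex.exp_sum, dotProduct, vc, Complex.ofReal_sum,
        Finset.mul_sum, ← Finset.sum_add_distrib]
      congr 1
      refine Finset.sum_congr rfl fun k _ => ?_
      push_cast
      ring
    rw [e]
    simp only [mulVec, dotProduct, vc, Finset.sum_mul]
    refine Finset.sum_congr rfl fun i _ => Finset.sum_congr rfl fun j _ => ?_
    ring
  simp only [h]
  have hI := integral_coord_mul_coord_mul_prod_shiftedGaussian m
  rw [(integral_finsetSum _ fun i _ => integrable_finsetSum _ fun j _ =>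
    (hI i j).1.const_mul (B i j)).trans (Finset.sum_congr rfl fun i _ =>
      (integral_finsetSum _ fun j _ => (hI i j).1.const_mul (B i j)).trans
        (Finset.sum_congr rfl fun j _ => (integral_const_mul _ _).trans
          (congrArg (B i j * ·) (hI i j).2)))]
  have hB : ∑ i, ∑ j, B i j * (m i * m j) = (B *ᵥ m) ⬝ᵥ m := by
    simp only [mulVec, dotProduct, Finset.sum_mul]
    exact Finset.sum_congr rfl fun i _ => Finset.sum_congr rfl fun j _ => by ring
  have hm : ∑ k, m k ^ 2 = m ⬝ᵥ m := by simp only [dotProduct, sq]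
  have hT : 1 / (2 * (Real.pi : ℂ)) * B.trace =
      ∑ i, ∑ j, B i j * (if i = j then 1 / (2 * (Real.pi : ℂ)) else 0) := by
    simp [trace, Finset.mul_sum, mul_comm]
  rw [← hB, ← hm, hT, ← Finset.sum_add_distrib, Finset.sum_mul]
  refine Finset.sum_congr rfl fun i _ => ?_
  rw [← Finset.sum_add_distrib, Finset.sum_mul]
  exact Finset.sum_congr rfl fun j _ => by ring

lemma vc_mulVec {N : ℕ} (S : Matrix (Fin N) (Fin N) ℝ) (v : Fin N → ℝ) :
    vc (S *ᵥ v) = mc S *ᵥ vc v := by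
  ext i
  simp [vc, mc, mulVec, dotProduct]

lemma mc_mul {N : ℕ} (S T : Matrix (Fin N) (Fin N) ℝ) : mc (S * T) = mc S * mc T :=
  Matrix.map_mul (f := Complex.ofRealHom)

lemma integral_comp_mulVec {N : ℕ} {S : Matrix (Fin N) (Fin N) ℝ} (hS : S.det ≠ 0)
    {f : (Fin N → ℝ) → ℂ} (hf : Continuous f) :
    ∫ u, f u = |S.det| * ∫ v, f (S *ᵥ v) := by
  have h := integral_map (μ := volume) (φ := toLin' S) (f := f)
    (LinearMap.continuous_of_finiteDimensional _).aemeasurable hf.aestronglyMeasurable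
  rw [Real.map_matrix_volume_pi_eq_smul_volume_pi hS, integral_smul_measure,
    ENNReal.toReal_ofReal (abs_nonneg _)] at h
  simp only [toLin'_apply] at h
  rw [← h, Complex.real_smul, ← mul_assoc, ← Complex.ofReal_mul, abs_inv,
    mul_inv_cancel₀ (abs_ne_zero.2 hS)]
  simp

open scoped MatrixOrder Matrix.Norms.L2Operator in
lemma Matrix.PosDef.exists_eq_mul_transpose {N : ℕ} {A : Matrix (Fin N) (Fin N) ℝ}
    (hA : A.PosDef) : ∃ S : Matrix (Fin N) (Fin N) ℝ, S.det ≠ 0 ∧ A = S * Sᵀ := by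
  obtain ⟨S, hS, rfl⟩ := CStarAlgebra.isStrictlyPositive_iff_eq_mul_star_self.mp
    hA.isStrictlyPositive
  exact ⟨S, ((Matrix.isUnit_iff_isUnit_det S).1 hS).ne_zero, by
    rw [star_eq_conjTranspose, conjTranspose_eq_transpose_of_trivial]⟩

/-- Second moment of a Gaussian with covariance `A / 2π` and complex mean `A b`. -/
lemma Matrix.PosDef.integral_quadratic_mul_gaussian {N : ℕ} {A : Matrix (Fin N) (Fin N) ℝ}
    (hA : A.PosDef) (B : Matrix (Fin N) (Fin N) ℂ) (b : Fin N → ℂ) :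
    ∫ u : Fin N → ℝ, ((B *ᵥ vc u) ⬝ᵥ vc u) *
        Complex.exp (-(Real.pi : ℂ) * (((A⁻¹ *ᵥ u) ⬝ᵥ u : ℝ) : ℂ) + 2 * Real.pi * (b ⬝ᵥ vc u)) =
      ((B *ᵥ (mc A *ᵥ b)) ⬝ᵥ (mc A *ᵥ b) + 1 / (2 * (Real.pi : ℂ)) * (mc A * B).trace) *
        ((Real.sqrt A.det : ℂ) * Complex.exp (Real.pi * (b ⬝ᵥ (mc A *ᵥ b)))) := by
  obtain ⟨S, hS, rfl⟩ := hA.exists_eq_mul_transpose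
  have hvc : Continuous (vc : (Fin N → ℝ) → Fin N → ℂ) := by unfold vc; fun_prop
  have hcont : Continuous fun u : Fin N → ℝ => ((B *ᵥ vc u) ⬝ᵥ vc u) *
      Complex.exp (-(Real.pi : ℂ) * ((((S * Sᵀ)⁻¹ *ᵥ u) ⬝ᵥ u : ℝ) : ℂ) +
        2 * Real.pi * (b ⬝ᵥ vc u)) := by
    fun_prop
  have hT : mc Sᵀ = (mc S)ᵀ := rfl
  have hquad (v : Fin N → ℝ) : (((S * Sᵀ)⁻¹ *ᵥ (S *ᵥ v)) ⬝ᵥ (S *ᵥ v)) = v ⬝ᵥ v := by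
    have hu : IsUnit S.det := hS.isUnit
    have hu' : IsUnit Sᵀ.det := by rwa [det_transpose]
    rw [mulVec_mulVec, mul_inv_rev, mul_assoc, nonsing_inv_mul _ hu, mul_one, dotProduct_mulVec,
      ← mulVec_transpose, mulVec_mulVec, mul_nonsing_inv _ hu', one_mulVec]
  have hmul (x y : Fin N → ℂ) : x ⬝ᵥ (mc S *ᵥ y) = ((mc S)ᵀ *ᵥ x) ⬝ᵥ y := by
    rw [dotProduct_mulVec, mulVec_transpose]
  have hdet : Real.sqrt (S * Sᵀ).det = |S.det| := by
    rw [det_mul, det_transpose, ← sq, Real.sqrt_sq_eq_abs]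
  have key := _root_.integral_quadratic_mul_gaussian ((mc S)ᵀ * B * mc S) ((mc S)ᵀ *ᵥ b)
  rw [integral_comp_mulVec hS hcont, hdet]
  simp only [hquad]
  simp only [vc_mulVec, hmul, mulVec_mulVec, mc_mul, hT] at key ⊢
  simp only [← Matrix.mul_assoc] at key ⊢
  rw [key, Matrix.trace_mul_comm ((mc S)ᵀ * B) (mc S), ← Matrix.mul_assoc]
  simp only [← mulVec_mulVec, hmul]
  ring

lemma J0_transpose (n : ℕ) : (J0 n)ᵀ = -J0 n := by
  ext i j
  simp only [J0, transpose_apply, Matrix.neg_apply, of_apply]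
  split_ifs <;> first | omega | simp

lemma J0_mul_J0 (n : ℕ) : J0 n * J0 n = -1 := by
  ext i j
  rw [mul_apply]
  obtain ⟨p, hp⟩ : ∃ p : Fin (2 * n), (i : ℕ) % 2 = 0 ∧ (p : ℕ) = i + 1 ∨
      (i : ℕ) % 2 = 1 ∧ (i : ℕ) = p + 1 := by
    rcases Nat.mod_two_eq_zero_or_one i with hi | hi
    · exact ⟨⟨i + 1, by omega⟩, .inl ⟨hi, rfl⟩⟩
    · exact ⟨⟨i - 1, by omega⟩, .inr ⟨hi, by simp only; omega⟩⟩
  rw [Finset.sum_eq_single p]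
  · simp only [J0, of_apply, Matrix.neg_apply, Matrix.one_apply, Fin.ext_iff]
    split_ifs <;> first | omega | simp
  · intro k _ hk
    rw [Ne, Fin.ext_iff] at hk
    have : J0 n i k = 0 := by
      simp only [J0, of_apply]
      split_ifs <;> first | omega | rfl
    rw [this, zero_mul]
  · simp

lemma Omega_swap (n : ℕ) (u v : Fin (2 * n) → ℝ) : Omega n u v = -Omega n v u := by
  rw [Omega, Omega, dotProduct_comm, dotProduct_mulVec, ← mulVec_transpose, J0_transpose,
    neg_mulVec, neg_dotProduct]

lemma Omega_mulVec (n : ℕ) (J : Matrix (Fin (2 * n)) (Fin (2 * n)) ℝ) (u v : Fin (2 * n) → ℝ) :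
    Omega n u (J *ᵥ v) = u ⬝ᵥ ((-J0 n * J) *ᵥ v) := by
  rw [Omega, ← mulVec_mulVec, dotProduct_mulVec u, ← mulVec_transpose, transpose_neg, J0_transpose,
    neg_neg]

namespace Compatible

variable {n : ℕ} {J : Matrix (Fin (2 * n)) (Fin (2 * n)) ℝ}

lemma transpose_eq (hJ : Compatible n J) : (-J0 n * J)ᵀ = -J0 n * J := by
  have h (u v : Fin (2 * n) → ℝ) : Omega n u (J *ᵥ v) = Omega n v (J *ᵥ u) := by
    rw [← hJ.2.1 u, mulVec_mulVec, hJ.1, Omega_swap]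
    simp [Omega, neg_mulVec, mulVec_neg]
  ext i j
  have hij := h (Pi.single j 1) (Pi.single i 1)
  rw [Omega_mulVec, Omega_mulVec] at hij
  simpa only [mulVec_single_one, single_one_dotProduct, transpose_apply, col_apply] using hij

lemma posDef (hJ : Compatible n J) : (-J0 n * J).PosDef := by
  refine .of_dotProduct_mulVec_pos ?_ fun v hv => ?_
  · rw [IsHermitian, conjTranspose_eq_transpose_of_trivial, hJ.transpose_eq]
  · simpa [Omega_mulVec] using hJ.2.2 v hv

lemma posDef_half (hJ : Compatible n J) : ((1 / 2 : ℝ) • (1 + -J0 n * J)).PosDef :=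
  (PosDef.one.add hJ.posDef).smul (by norm_num)

lemma posDef_Amat (hJ : Compatible n J) : (Amat n (J0 n) J).PosDef :=
  hJ.posDef_half.inv

lemma Amat_inv (hJ : Compatible n J) :
    (Amat n (J0 n) J)⁻¹ = (1 / 2 : ℝ) • (1 + -J0 n * J) :=
  nonsing_inv_nonsing_inv _ ((isUnit_iff_isUnit_det _).1 hJ.posDef_half.isUnit)

/-- The metric `-J₀J` is symplectic. -/
lemma mul_J0_mul (hJ : Compatible n J) : (-J0 n * J) * J0 n * (-J0 n * J) = J0 n := by
  have h : (-J0 n * J) * J0 n * (-J0 n * J) = J0 n * J * (J0 n * J0 n) * J := by noncomm_ring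
  rw [h, J0_mul_J0, mul_neg_one, neg_mul, mul_assoc, hJ.1, mul_neg_one, neg_neg]

lemma Amat_mul (hJ : Compatible n J) : Amat n (J0 n) J * (1 + -J0 n * J) = (2 : ℝ) • 1 := by
  have h := nonsing_inv_mul _ ((isUnit_iff_isUnit_det _).1 hJ.posDef_half.isUnit)
  rw [mul_smul_comm] at h
  calc Amat n (J0 n) J * (1 + -J0 n * J)
      = (2 : ℝ) • ((1 / 2 : ℝ) • (Amat n (J0 n) J * (1 + -J0 n * J))) := by
        rw [smul_smul, mul_one_div_cancel two_ne_zero, one_smul]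
    _ = (2 : ℝ) • 1 := congrArg _ h

lemma mul_Amat (hJ : Compatible n J) : (1 + -J0 n * J) * Amat n (J0 n) J = (2 : ℝ) • 1 := by
  have h := mul_nonsing_inv _ ((isUnit_iff_isUnit_det _).1 hJ.posDef_half.isUnit)
  rw [smul_mul_assoc] at h
  calc (1 + -J0 n * J) * Amat n (J0 n) J
      = (2 : ℝ) • ((1 / 2 : ℝ) • ((1 + -J0 n * J) * Amat n (J0 n) J)) := by
        rw [smul_smul, mul_one_div_cancel two_ne_zero, one_smul]
    _ = (2 : ℝ) • 1 := congrArg _ h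

lemma metric_mul_Amat (hJ : Compatible n J) :
    (-J0 n * J) * Amat n (J0 n) J = (2 : ℝ) • 1 - Amat n (J0 n) J := by
  rw [← hJ.mul_Amat, add_mul, one_mul, add_sub_cancel_left]

lemma Amat_mul_metric (hJ : Compatible n J) :
    Amat n (J0 n) J * (-J0 n * J) = (2 : ℝ) • 1 - Amat n (J0 n) J := by
  rw [← hJ.Amat_mul, mul_add, mul_one, add_sub_cancel_left]

lemma Amat_mul_J0 (hJ : Compatible n J) :
    Amat n (J0 n) J * J0 n = (2 : ℝ) • J0 n - J0 n * Amat n (J0 n) J := by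
  set G := -J0 n * J
  set A := Amat n (J0 n) J
  have h1 : J0 n * (1 + G) = (1 + G) * (J0 n * G) := by
    rw [add_mul, one_mul, ← mul_assoc G, hJ.mul_J0_mul, mul_add, mul_one, add_comm]
  have h2 : (2 : ℝ) • (A * J0 n) = (2 : ℝ) • (J0 n * (G * A)) := by
    calc (2 : ℝ) • (A * J0 n) = A * (J0 n * (1 + G)) * A := by
          rw [mul_assoc, mul_assoc, hJ.mul_Amat]
          simp
      _ = (2 : ℝ) • (J0 n * (G * A)) := by
          rw [h1, ← mul_assoc A, hJ.Amat_mul]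
          simp [mul_assoc]
  rw [smul_right_injective _ (two_ne_zero (α := ℝ)) h2, hJ.metric_mul_Amat, mul_sub,
    mul_smul_comm, mul_one]

lemma J0_mul_metric (n : ℕ) (J : Matrix (Fin (2 * n)) (Fin (2 * n)) ℝ) :
    J0 n * (-J0 n * J) = J := by
  rw [← mul_assoc, mul_neg, J0_mul_J0, neg_neg, one_mul]

lemma Amat_symm (hJ : Compatible n J) :
    Amat n J (J0 n) = (2 : ℝ) • 1 - Amat n (J0 n) J := by
  refine inv_eq_right_inv ?_
  have h : (1 + -J * J0 n) * (-J0 n * J) = 1 + -J0 n * J := by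
    have h1 : J * J0 n * (-J0 n * J) = -1 := by
      rw [mul_assoc, J0_mul_metric, hJ.1]
    rw [add_mul, one_mul, neg_mul J, neg_mul (J * J0 n), h1, neg_neg, add_comm]
  rw [← hJ.metric_mul_Amat, smul_mul_assoc, ← mul_assoc, h, hJ.mul_Amat, smul_smul]
  norm_num

lemma Amat_symm_mul (hJ : Compatible n J) :
    Amat n J (J0 n) * J = Amat n (J0 n) J * J0 n := by
  have h : (-J0 n * J) * J = J0 n := by rw [mul_assoc, hJ.1, mul_neg_one, neg_neg]
  rw [hJ.Amat_symm, ← hJ.Amat_mul_metric, mul_assoc, h]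

end Compatible

lemma mc_sub {N : ℕ} (S T : Matrix (Fin N) (Fin N) ℝ) : mc (S - T) = mc S - mc T := by
  ext; simp [mc]

lemma mc_smul {N : ℕ} (c : ℝ) (S : Matrix (Fin N) (Fin N) ℝ) : mc (c • S) = (c : ℂ) • mc S := by
  ext; simp [mc]

lemma mc_one {N : ℕ} : mc (1 : Matrix (Fin N) (Fin N) ℝ) = 1 :=
  Matrix.map_one _ Complex.ofReal_zero Complex.ofReal_one

lemma vc_sub {N : ℕ} (u v : Fin N → ℝ) : vc (u - v) = vc u - vc v := by
  ext; simp [vc]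

lemma vc_dotProduct {N : ℕ} (u v : Fin N → ℝ) : vc u ⬝ᵥ vc v = ((u ⬝ᵥ v : ℝ) : ℂ) := by
  simp [vc, dotProduct]

lemma PiT0_map_star (n : ℕ) (J : Matrix (Fin (2 * n)) (Fin (2 * n)) ℝ) :
    (PiT0 n J).map (starRingEnd ℂ) = mc (Amat n (J0 n) J) * P01 (J0 n) := by
  rw [PiT0, Matrix.map_mul]
  congr 1
  · ext; simp [mc]
  · ext i j
    by_cases h : i = j <;> simp [P10, P01, mc, h, Complex.conj_ofNat]

lemma P10_mul_Amat_mul_P01 {n : ℕ} {J : Matrix (Fin (2 * n)) (Fin (2 * n)) ℝ}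
    (hJ : Compatible n J) :
    P10 (J0 n) * mc (Amat n (J0 n) J) * P01 (J0 n) =
      (1 / 2 : ℂ) • 1 - Pi0T n J - (Complex.I / 2) • mc (J0 n) := by
  have h1 := congrArg mc hJ.Amat_mul_J0
  have h2 := congrArg mc hJ.Amat_symm
  have h3 := congrArg mc hJ.Amat_symm_mul
  have h4 : mc (J0 n) * mc (J0 n) = -1 := by
    rw [← mc_mul, J0_mul_J0]
    ext i j
    by_cases h : i = j <;> simp [mc, h]
  simp only [mc_mul, mc_sub, mc_smul, mc_one] at h1 h2 h3
  have hPi : Pi0T n J = (1 / 2 : ℂ) • (((2 : ℝ) : ℂ) • 1 - mc (Amat n (J0 n) J) -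
      Complex.I • (mc (Amat n (J0 n) J) * mc (J0 n))) := by
    rw [Pi0T, P10, mul_smul_comm, mul_sub, mul_one, mul_smul_comm, h3, h2]
  have h5 : mc (J0 n) * mc (Amat n (J0 n) J) * mc (J0 n) =
      -((2 : ℝ) : ℂ) • 1 + mc (Amat n (J0 n) J) := by
    rw [mul_assoc, h1, mul_sub, mul_smul_comm, ← mul_assoc, h4]
    simp
  simp only [hPi, P10, P01, smul_mul_assoc, mul_smul_comm, mul_add, sub_mul, mul_one, one_mul, h5,
    h1]
  match_scalars <;> ring_nf <;> simp only [Complex.I_sq] <;> norm_num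

lemma P10_transpose_P01 (n : ℕ) : (P01 (J0 n))ᵀ = P10 (J0 n) := by
  have h : (mc (J0 n))ᵀ = -mc (J0 n) := by
    rw [mc, ← transpose_map, J0_transpose]
    ext; simp
  simp [P01, P10, h, sub_eq_add_neg]

lemma P01_mulVec_dotProduct (n : ℕ) (d u : Fin (2 * n) → ℝ) :
    (P01 (J0 n) *ᵥ vc d) ⬝ᵥ vc u =
      1 / 2 * ((d ⬝ᵥ u : ℝ) : ℂ) + Complex.I / 2 * (Omega n d u : ℂ) := by
  rw [P01, smul_mulVec, add_mulVec, one_mulVec, smul_mulVec, ← vc_mulVec, smul_dotProduct,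
    add_dotProduct, smul_dotProduct, vc_dotProduct, vc_dotProduct, Omega]
  simp only [smul_eq_mul]
  ring

lemma Pker_mul_Pker {n : ℕ} {J : Matrix (Fin (2 * n)) (Fin (2 * n)) ℝ}
    (hJ : Compatible n J) (Z Z' u : Fin (2 * n) → ℝ) :
    Pker n J Z (Z - u) * Pker n (J0 n) (Z - u) Z' =
      Complex.exp (-(Real.pi : ℂ) * (1 / 2 * (((Z - Z') ⬝ᵥ (Z - Z') : ℝ) : ℂ) +
        Complex.I * (Omega n Z Z' : ℂ))) *
      Complex.exp (-(Real.pi : ℂ) * ((((Amat n (J0 n) J)⁻¹ *ᵥ u) ⬝ᵥ u : ℝ) : ℂ) +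
        2 * Real.pi * ((P01 (J0 n) *ᵥ vc (Z - Z')) ⬝ᵥ vc u)) := by
  have hO : Omega n Z (Z - u) + Omega n (Z - u) Z' = Omega n Z Z' - Omega n (Z - Z') u := by
    have h1 := Omega_swap n Z Z
    have h2 := Omega_swap n u Z'
    simp only [Omega, mulVec_sub, sub_dotProduct, dotProduct_sub] at h1 h2 ⊢
    linarith
  have hd : (Z - u - Z') ⬝ᵥ (Z - u - Z') =
      (Z - Z') ⬝ᵥ (Z - Z') - 2 * ((Z - Z') ⬝ᵥ u) + u ⬝ᵥ u := by
    have h1 := dotProduct_comm u (Z - Z')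
    rw [sub_right_comm, sub_dotProduct (Z - Z'), dotProduct_sub (Z - Z') _ u, dotProduct_sub u, h1]
    ring
  have hO' := congrArg Complex.ofReal hO
  have hd' := congrArg Complex.ofReal hd
  push_cast at hO' hd'
  simp only [Pker]
  rw [← Complex.exp_add, ← Complex.exp_add, P01_mulVec_dotProduct, hJ.Amat_inv, sub_sub_cancel,
    neg_mul (J0 n) (J0 n), J0_mul_J0, neg_neg, one_mulVec, smul_mulVec, add_mulVec, one_mulVec,
    smul_dotProduct, add_dotProduct, smul_eq_mul]
  congr 1
  push_cast
  linear_combination (-(Real.pi : ℂ) / 2) * hd' - (Real.pi : ℂ) * Complex.I * hO'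

lemma PtP0form_eq {n : ℕ} {J : Matrix (Fin (2 * n)) (Fin (2 * n)) ℝ}
    (hJ : Compatible n J) (Z Z' : Fin (2 * n) → ℝ) :
    PtP0form n J Z Z' =
      Complex.exp (-(Real.pi : ℂ) * (1 / 2 * (((Z - Z') ⬝ᵥ (Z - Z') : ℝ) : ℂ) +
        Complex.I * (Omega n Z Z' : ℂ))) *
      ((Real.sqrt (Amat n (J0 n) J).det : ℂ) *
        Complex.exp (Real.pi * ((P01 (J0 n) *ᵥ vc (Z - Z')) ⬝ᵥ
          (mc (Amat n (J0 n) J) *ᵥ (P01 (J0 n) *ᵥ vc (Z - Z')))))) := by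
  rw [PtP0form, ← vc_sub]
  set d := Z - Z'
  have hself : Omega n d d = 0 := by linarith [Omega_swap n d d]
  have h : (P01 (J0 n) *ᵥ vc d) ⬝ᵥ (mc (Amat n (J0 n) J) *ᵥ (P01 (J0 n) *ᵥ vc d)) =
      1 / 2 * ((d ⬝ᵥ d : ℝ) : ℂ) - (Pi0T n J *ᵥ vc d) ⬝ᵥ vc d := by
    rw [dotProduct_comm, dotProduct_mulVec, ← mulVec_transpose, P10_transpose_P01, mulVec_mulVec,
      mulVec_mulVec, P10_mul_Amat_mul_P01 hJ, sub_mulVec, sub_mulVec, smul_mulVec,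
      smul_mulVec, one_mulVec, ← vc_mulVec, sub_dotProduct, sub_dotProduct, smul_dotProduct,
      smul_dotProduct, vc_dotProduct, vc_dotProduct, ← Omega, hself]
    simp
  rw [h, mul_left_comm, ← Complex.exp_add]
  congr 2
  ring

/-- Gaussian integration of a quadratic polynomial against the model
kernels: ∫ 𝒫_t(Z,W)⟨B(Z-W),Z-W⟩𝒫_0(W,Z')dW
= (⟨B·conj(Π_t^0)(Z-Z'), conj(Π_t^0)(Z-Z')⟩ + (1/2π)Tr[A_t^0 B])·(𝒫_t𝒫_0)(Z,Z'). -/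
theorem stmt6 (n : ℕ) (Jt : Matrix (Fin (2*n)) (Fin (2*n)) ℝ) (hJ : Compatible n Jt)
    (B : Matrix (Fin (2*n)) (Fin (2*n)) ℂ) :
    ∀ Z Z' : Fin (2*n) → ℝ,
      (∫ W : Fin (2*n) → ℝ,
          Pker n Jt Z W * ((B *ᵥ (vc Z - vc W)) ⬝ᵥ (vc Z - vc W)) * Pker n (J0 n) W Z')
        = ((B *ᵥ ((PiT0 n Jt).map (⇑(starRingEnd ℂ)) *ᵥ (vc Z - vc Z'))) ⬝ᵥ
              ((PiT0 n Jt).map (⇑(starRingEnd ℂ)) *ᵥ (vc Z - vc Z'))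
            + 1/(2*(Real.pi : ℂ)) * Matrix.trace (mc (Amat n (J0 n) Jt) * B))
          * PtP0form n Jt Z Z' := by
  intro Z Z'
  rw [PtP0form_eq hJ, PiT0_map_star, ← vc_sub, ← mulVec_mulVec, mul_left_comm,
    ← hJ.posDef_Amat.integral_quadratic_mul_gaussian B (P01 (J0 n) *ᵥ vc (Z - Z')),
    ← integral_const_mul, ← integral_sub_left_eq_self _ volume Z]
  refine integral_congr_ae (.of_forall fun u => ?_)
  simp only
  rw [← vc_sub, sub_sub_cancel, mul_right_comm, Pker_mul_Pker hJ]
  ring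

end
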